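/- With K, σ₁, σ₂ and the operators D̃₁, …, D̃₆ : K → K as in the context (type G₂ Demazure-type operators), the operator identity D̃₁∘D̃₂∘D̃₃∘D̃₄∘D̃₅∘D̃₆ = D̃₆∘D̃₅∘D̃₄∘D̃₃∘D̃₂∘D̃₁ holds, i.e., for every f ∈ K, D̃₁(D̃₂(D̃₃(D̃₄(D̃₅(D̃₆(f)))))) = D̃₆(D̃₅(D̃₄(D̃₃(D̃₂(D̃₁(f)))))). (Lemma 3.3(8).) -/

import Mathlib

noncomputable section

local notation "K" => FractionRing (MvPolynomial (Fin 2) ℤ)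

noncomputable def t1 : FractionRing (MvPolynomial (Fin 2) ℤ) :=
  algebraMap (MvPolynomial (Fin 2) ℤ) _ (MvPolynomial.X 0)

noncomputable def t2 : FractionRing (MvPolynomial (Fin 2) ℤ) :=
  algebraMap (MvPolynomial (Fin 2) ℤ) _ (MvPolynomial.X 1)

theorem ringHom_ext_of_t1_t2 {R : Type*} [Ring R]
    {φ ψ : FractionRing (MvPolynomial (Fin 2) ℤ) →+* R} (h1 : φ t1 = ψ t1) (h2 : φ t2 = ψ t2) :
    φ = ψ := by
  apply IsLocalization.ringHom_ext (nonZeroDivisors (MvPolynomial (Fin 2) ℤ))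
  apply MvPolynomial.ringHom_ext
  · intro n
    simp
  · intro i
    fin_cases i
    · exact h1
    · exact h2

theorem one_sub_t1_pow_mul_t2_pow_ne_zero {a b : ℕ} (h : a + b ≠ 0) :
    1 - t1 ^ a * t2 ^ b ≠ 0 := by
  intro h0
  have h1 : algebraMap (MvPolynomial (Fin 2) ℤ) (FractionRing (MvPolynomial (Fin 2) ℤ))
      (1 - MvPolynomial.X 0 ^ a * MvPolynomial.X 1 ^ b) = 0 := by
    simpa [t1, t2] using h0
  rw [FaithfulSMul.algebraMap_eq_zero_iff] at h1
  have h2 := congrArg (MvPolynomial.eval 0) h1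
  simp [← pow_add, zero_pow h] at h2

theorem t1_ne_zero : t1 ≠ 0 := by
  simp [t1]

theorem t2_ne_zero : t2 ≠ 0 := by
  simp [t2]

/-- The longest-word identity for Demazure-type operators of type `G₂`, in any field carrying an
action of the dihedral group of order 12 that is compatible with the root lattice. -/
theorem demazure_comp_eq_reverse {F : Type*} [Field F] (σ1 σ2 : F ≃+* F) {x y : F}
    (hx : x ≠ 0) (hy : y ≠ 0) (n1 : 1 - x ≠ 0) (n2 : 1 - x ^ 3 * y ≠ 0)
    (n3 : 1 - x ^ 2 * y ≠ 0) (n4 : 1 - x ^ 3 * y ^ 2 ≠ 0) (n5 : 1 - x * y ≠ 0) (n6 : 1 - y ≠ 0)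
    (h11 : σ1 x = x⁻¹) (h12 : σ1 y = x ^ 3 * y) (h21 : σ2 x = x * y) (h22 : σ2 y = y⁻¹)
    (i1 : ∀ z, σ1 (σ1 z) = z) (i2 : ∀ z, σ2 (σ2 z) = z)
    (br : ∀ z, σ2 (σ1 (σ2 (σ1 (σ2 (σ1 z))))) = σ1 (σ2 (σ1 (σ2 (σ1 (σ2 z))))))
    (D1 D2 : F → F) (hD1 : ∀ f, D1 f = (1 - x)⁻¹ * (f - σ1 f))
    (hD2 : ∀ f, D2 f = (1 - y)⁻¹ * (f - σ2 f)) (f : F) :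
    D1 (σ1 (D2 (σ1 (σ1 (σ2 (D1 (σ2 (σ1 (σ2 (σ1 (D2 (σ1 (σ2 (σ2 (D1 (σ2 (D2 f))))))))))))))))) =
      D2 (σ2 (D1 (σ2 (σ2 (σ1 (D2 (σ1 (σ2 (σ1 (σ2 (D1 (σ2 (σ1 (σ1 (D2 (σ1 (D1 f))))))))))))))))) := by
  obtain ⟨u1, e1⟩ : ∃ u, u = (1 - x)⁻¹ := ⟨_, rfl⟩
  obtain ⟨u2, e2⟩ : ∃ u, u = (1 - x ^ 3 * y)⁻¹ := ⟨_, rfl⟩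
  obtain ⟨u3, e3⟩ : ∃ u, u = (1 - x ^ 2 * y)⁻¹ := ⟨_, rfl⟩
  obtain ⟨u4, e4⟩ : ∃ u, u = (1 - x ^ 3 * y ^ 2)⁻¹ := ⟨_, rfl⟩
  obtain ⟨u5, e5⟩ : ∃ u, u = (1 - x * y)⁻¹ := ⟨_, rfl⟩
  obtain ⟨u6, e6⟩ : ∃ u, u = (1 - y)⁻¹ := ⟨_, rfl⟩
  have inv_one_sub_inv : ∀ z : F, z ≠ 0 → 1 - z ≠ 0 → (1 - z⁻¹)⁻¹ = 1 - (1 - z)⁻¹ := by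
    intro z hz hz'
    have : z - 1 ≠ 0 := by rwa [← neg_ne_zero, neg_sub]
    field_simp
    ring
  have a11 : σ1 u1 = 1 - u1 := by simp [e1, h11, inv_one_sub_inv _ hx n1]
  have a12 : σ1 u2 = u6 := by simp [e2, e6, h11, h12]; field_simp
  have a13 : σ1 u3 = u5 := by simp [e3, e5, h11, h12]; field_simp
  have a14 : σ1 u4 = u4 := by simp [e4, h11, h12]; field_simp
  have a15 : σ1 u5 = u3 := by simp [e3, e5, h11, h12]; field_simp
  have a16 : σ1 u6 = u2 := by simp [e2, e6, h12]
  have a21 : σ2 u1 = u5 := by simp [e1, e5, h21]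
  have a22 : σ2 u2 = u4 := by simp [e2, e4, h21, h22]; field_simp
  have a23 : σ2 u3 = u3 := by simp [e3, h21, h22]; field_simp
  have a24 : σ2 u4 = u2 := by simp [e2, e4, h21, h22]; field_simp
  have a25 : σ2 u5 = u1 := by simp [e1, e5, h21, h22]; field_simp
  have a26 : σ2 u6 = 1 - u6 := by simp [e6, h22, inv_one_sub_inv _ hy n6]
  rw [← e1] at hD1
  rw [← e6] at hD2
  clear h11 h12 h21 h22
  have h12 :
      u1 * u2 * u3 * u4 * u5 * u6 =
      u2 * (1 - u3) * u3 * u4 * u5 * u6 + u3 * u3 * (1 - u4) * u4 * u5 * u6 +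
      u3 * u4 * u4 * (1 - u5) * u5 * u6 + u3 * u4 * u5 * u5 * (1 - u6) * u6 +
      u1 * u3 * u4 * u5 * u6 * u6 := by
    clear * - e1 e2 e3 e4 e5 e6 n1 n2 n3 n4 n5 n6
    subst e1 e2 e3 e4 e5 e6
    field_simp
    ring
  have h121 :
      (1 - u1) * u1 * u2 * u4 * u5 * u6 + u1 * u3 * (1 - u4) * u4 * u5 * u6 +
      u1 * u4 * u4 * (1 - u5) * u5 * u6 + u1 * u4 * u5 * u5 * (1 - u6) * u6 +
      u1 * u1 * u4 * u5 * u6 * u6 =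
      u2 * (1 - u3) * u3 * u4 * u5 * u6 + u3 * u3 * (1 - u4) * u4 * u5 * u6 +
      u3 * u4 * u4 * (1 - u5) * u5 * u6 + u3 * u4 * u5 * u5 * (1 - u6) * u6 +
      u1 * u3 * u4 * u5 * u6 * u6 := by
    clear * - e1 e2 e3 e4 e5 e6 n1 n2 n3 n4 n5 n6
    subst e1 e2 e3 e4 e5 e6
    field_simp
    ring
  have h1212 :
      (1 - u1) * u1 * u2 * u4 * u5 * u6 + u1 * u3 * (1 - u4) * u4 * u5 * u6 +
      u1 * u4 * u4 * (1 - u5) * u5 * u6 + u1 * u4 * u5 * u5 * (1 - u6) * u6 +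
      u1 * u1 * u4 * u5 * u6 * u6 =
      u3 * (1 - u4) * u4 * (1 - u5) * u5 * u6 + u4 * (1 - u5) * u5 * u5 * (1 - u6) * u6 +
      u4 * u4 * (1 - u5) * (1 - u5) * u5 * u6 + u1 * u5 * u5 * (1 - u6) * u6 * u6 +
      u4 * (1 - u5) * u5 * u5 * (1 - u6) * u6 + u5 * u5 * u5 * (1 - u6) * (1 - u6) * u6 +
      (1 - u1) * u1 * u2 * u5 * u6 * u6 + u1 * u4 * (1 - u5) * u5 * u6 * u6 +
      u1 * u5 * u5 * (1 - u6) * u6 * u6 + u1 * u1 * u5 * u6 * u6 * u6 := by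
    clear * - e1 e2 e3 e4 e5 e6 n1 n2 n3 n4 n5 n6
    subst e1 e2 e3 e4 e5 e6
    field_simp
    ring
  have h12121 :
      (1 - u1) * u1 * (1 - u2) * u2 * u3 * u6 + (1 - u1) * u1 * u2 * u5 * (1 - u6) * u6 +
      (1 - u1) * u1 * u1 * u2 * u6 * u6 + (1 - u1) * (1 - u1) * u1 * u2 * u2 * u6 +
      u1 * u4 * (1 - u5) * u5 * (1 - u6) * u6 + u1 * u1 * u5 * (1 - u6) * u6 * u6 +
      u1 * u5 * u5 * (1 - u6) * (1 - u6) * u6 + (1 - u1) * u1 * u1 * u2 * u6 * u6 +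
      u1 * u1 * u5 * (1 - u6) * u6 * u6 + u1 * u1 * u1 * u6 * u6 * u6 =
      u3 * (1 - u4) * u4 * (1 - u5) * u5 * u6 + u4 * (1 - u5) * u5 * u5 * (1 - u6) * u6 +
      u4 * u4 * (1 - u5) * (1 - u5) * u5 * u6 + u1 * u5 * u5 * (1 - u6) * u6 * u6 +
      u4 * (1 - u5) * u5 * u5 * (1 - u6) * u6 + u5 * u5 * u5 * (1 - u6) * (1 - u6) * u6 +
      (1 - u1) * u1 * u2 * u5 * u6 * u6 + u1 * u4 * (1 - u5) * u5 * u6 * u6 +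
      u1 * u5 * u5 * (1 - u6) * u6 * u6 + u1 * u1 * u5 * u6 * u6 * u6 := by
    clear * - e1 e2 e3 e4 e5 e6 n1 n2 n3 n4 n5 n6
    subst e1 e2 e3 e4 e5 e6
    field_simp
    ring
  have h21 :
      u1 * u2 * u3 * (1 - u4) * u4 * u5 + u1 * u2 * (1 - u3) * u3 * u4 * u4 +
      u1 * (1 - u2) * u2 * u3 * u3 * u4 + (1 - u1) * u1 * u2 * u2 * u3 * u4 +
      u1 * u1 * u2 * u3 * u4 * u6 =
      u1 * u2 * u3 * u4 * u5 * u6 := by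
    clear * - e1 e2 e3 e4 e5 e6 n1 n2 n3 n4 n5 n6
    subst e1 e2 e3 e4 e5 e6
    field_simp
    ring
  have h212 :
      u1 * u2 * u3 * (1 - u4) * u4 * u5 + u1 * u2 * (1 - u3) * u3 * u4 * u4 +
      u1 * (1 - u2) * u2 * u3 * u3 * u4 + (1 - u1) * u1 * u2 * u2 * u3 * u4 +
      u1 * u1 * u2 * u3 * u4 * u6 =
      u1 * u2 * u3 * u5 * (1 - u6) * u6 + u1 * u2 * (1 - u3) * u3 * u4 * u6 +
      u1 * (1 - u2) * u2 * u3 * u3 * u6 + (1 - u1) * u1 * u2 * u2 * u3 * u6 +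
      u1 * u1 * u2 * u3 * u6 * u6 := by
    clear * - e1 e2 e3 e4 e5 e6 n1 n2 n3 n4 n5 n6
    subst e1 e2 e3 e4 e5 e6
    field_simp
    ring
  have h2121 :
      u1 * (1 - u2) * u2 * (1 - u3) * u3 * u4 + (1 - u1) * u1 * (1 - u2) * u2 * u2 * u3 +
      u1 * (1 - u2) * (1 - u2) * u2 * u3 * u3 + (1 - u1) * u1 * u1 * u2 * u2 * u6 +
      (1 - u1) * u1 * (1 - u2) * u2 * u2 * u3 + (1 - u1) * (1 - u1) * u1 * u2 * u2 * u2 +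
      u1 * u1 * u2 * u5 * (1 - u6) * u6 + u1 * u1 * (1 - u2) * u2 * u3 * u6 +
      (1 - u1) * u1 * u1 * u2 * u2 * u6 + u1 * u1 * u1 * u2 * u6 * u6 =
      u1 * u2 * u3 * u5 * (1 - u6) * u6 + u1 * u2 * (1 - u3) * u3 * u4 * u6 +
      u1 * (1 - u2) * u2 * u3 * u3 * u6 + (1 - u1) * u1 * u2 * u2 * u3 * u6 +
      u1 * u1 * u2 * u3 * u6 * u6 := by
    clear * - e1 e2 e3 e4 e5 e6 n1 n2 n3 n4 n5 n6
    subst e1 e2 e3 e4 e5 e6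
    field_simp
    ring
  have h21212 :
      u1 * (1 - u2) * u2 * (1 - u3) * u3 * u4 + (1 - u1) * u1 * (1 - u2) * u2 * u2 * u3 +
      u1 * (1 - u2) * (1 - u2) * u2 * u3 * u3 + (1 - u1) * u1 * u1 * u2 * u2 * u6 +
      (1 - u1) * u1 * (1 - u2) * u2 * u2 * u3 + (1 - u1) * (1 - u1) * u1 * u2 * u2 * u2 +
      u1 * u1 * u2 * u5 * (1 - u6) * u6 + u1 * u1 * (1 - u2) * u2 * u3 * u6 +
      (1 - u1) * u1 * u1 * u2 * u2 * u6 + u1 * u1 * u1 * u2 * u6 * u6 =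
      u1 * u4 * (1 - u5) * u5 * (1 - u6) * u6 + (1 - u1) * u1 * u2 * u5 * (1 - u6) * u6 +
      u1 * u1 * u5 * (1 - u6) * u6 * u6 + u1 * u5 * u5 * (1 - u6) * (1 - u6) * u6 +
      (1 - u1) * u1 * (1 - u2) * u2 * u3 * u6 + (1 - u1) * u1 * u1 * u2 * u6 * u6 +
      (1 - u1) * (1 - u1) * u1 * u2 * u2 * u6 + u1 * u1 * u5 * (1 - u6) * u6 * u6 +
      (1 - u1) * u1 * u1 * u2 * u6 * u6 + u1 * u1 * u1 * u6 * u6 * u6 := by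
    clear * - e1 e2 e3 e4 e5 e6 n1 n2 n3 n4 n5 n6
    subst e1 e2 e3 e4 e5 e6
    field_simp
    ring
  simp only [hD1, hD2, map_mul, map_sub, map_one, a11, a12, a13, a14, a15,
    a16, a21, a22, a23, a24, a25, a26, sub_sub_cancel, i1, i2, br]
  generalize σ1 (σ2 (σ1 (σ2 (σ1 (σ2 f))))) = f121212
  generalize σ1 (σ2 (σ1 (σ2 (σ1 f)))) = f12121
  generalize σ2 (σ1 (σ2 (σ1 (σ2 f)))) = f21212
  generalize σ1 (σ2 (σ1 (σ2 f))) = f1212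
  generalize σ2 (σ1 (σ2 (σ1 f))) = f2121
  generalize σ1 (σ2 (σ1 f)) = f121
  generalize σ2 (σ1 (σ2 f)) = f212
  generalize σ1 (σ2 f) = f12
  generalize σ2 (σ1 f) = f21
  generalize σ1 f = f1
  generalize σ2 f = f2
  linear_combination f12 * h12 - f121 * h121 + f1212 * h1212 - f12121 * h12121 + f21 * h21 -
    f212 * h212 + f2121 * h2121 - f21212 * h21212

theorem stmt_16 (σ1 σ2 : K ≃+* K)
    (h11 : σ1 t1 = t1⁻¹) (h12 : σ1 t2 = t1 ^ 3 * t2)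
    (h21 : σ2 t1 = t1 * t2) (h22 : σ2 t2 = t2⁻¹)
    (D1 D2 : K → K)
    (hD1 : ∀ f, D1 f = (1 - t1)⁻¹ * (f - σ1 f))
    (hD2 : ∀ f, D2 f = (1 - t2)⁻¹ * (f - σ2 f))
    (Dt1 Dt2 Dt3 Dt4 Dt5 Dt6 : K → K)
    (hDt1 : Dt1 = D1)
    (hDt2 : Dt2 = ⇑σ1 ∘ D2 ∘ ⇑σ1)
    (hDt3 : Dt3 = ⇑σ1 ∘ ⇑σ2 ∘ D1 ∘ ⇑σ2 ∘ ⇑σ1)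
    (hDt4 : Dt4 = ⇑σ2 ∘ ⇑σ1 ∘ D2 ∘ ⇑σ1 ∘ ⇑σ2)
    (hDt5 : Dt5 = ⇑σ2 ∘ D1 ∘ ⇑σ2)
    (hDt6 : Dt6 = D2) :
    ∀ f : K, Dt1 (Dt2 (Dt3 (Dt4 (Dt5 (Dt6 f))))) = Dt6 (Dt5 (Dt4 (Dt3 (Dt2 (Dt1 f))))) := by
  have hx := t1_ne_zero
  have hy := t2_ne_zero
  have n1 : 1 - t1 ≠ 0 := by
    simpa using one_sub_t1_pow_mul_t2_pow_ne_zero (a := 1) (b := 0) (by simp)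
  have n2 : 1 - t1 ^ 3 * t2 ≠ 0 := by
    simpa using one_sub_t1_pow_mul_t2_pow_ne_zero (a := 3) (b := 1) (by simp)
  have n3 : 1 - t1 ^ 2 * t2 ≠ 0 := by
    simpa using one_sub_t1_pow_mul_t2_pow_ne_zero (a := 2) (b := 1) (by simp)
  have n4 : 1 - t1 ^ 3 * t2 ^ 2 ≠ 0 :=
    one_sub_t1_pow_mul_t2_pow_ne_zero (a := 3) (b := 2) (by simp)
  have n5 : 1 - t1 * t2 ≠ 0 := by
    simpa using one_sub_t1_pow_mul_t2_pow_ne_zero (a := 1) (b := 1) (by simp)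
  have n6 : 1 - t2 ≠ 0 := by
    simpa using one_sub_t1_pow_mul_t2_pow_ne_zero (a := 0) (b := 1) (by simp)
  have i1 : ∀ z, σ1 (σ1 z) = z := by
    refine DFunLike.congr_fun (ringHom_ext_of_t1_t2
      (φ := (σ1 : K →+* K).comp σ1) (ψ := RingHom.id K) ?_ ?_)
    all_goals simp [h11, h12]
    field_simp
  have i2 : ∀ z, σ2 (σ2 z) = z := by
    refine DFunLike.congr_fun (ringHom_ext_of_t1_t2
      (φ := (σ2 : K →+* K).comp σ2) (ψ := RingHom.id K) ?_ ?_)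
    all_goals simp [h21, h22]
    field_simp
  have br : ∀ z, σ2 (σ1 (σ2 (σ1 (σ2 (σ1 z))))) = σ1 (σ2 (σ1 (σ2 (σ1 (σ2 z))))) := by
    refine DFunLike.congr_fun (ringHom_ext_of_t1_t2
      (φ := (σ2 : K →+* K).comp <| (σ1 : K →+* K).comp <| (σ2 : K →+* K).comp <|
        (σ1 : K →+* K).comp <| (σ2 : K →+* K).comp σ1)
      (ψ := (σ1 : K →+* K).comp <| (σ2 : K →+* K).comp <| (σ1 : K →+* K).comp <|
        (σ2 : K →+* K).comp <| (σ1 : K →+* K).comp σ2) ?_ ?_)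
    all_goals
      simp [h11, h12, h21, h22]
      field_simp
  intro f
  subst hDt1 hDt2 hDt3 hDt4 hDt5 hDt6
  exact demazure_comp_eq_reverse σ1 σ2 hx hy n1 n2 n3 n4 n5 n6 h11 h12 h21 h22 i1 i2 br
    _ _ hD1 hD2 f
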